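/- Let X ∈ ℝ^{n×p}, y ∈ ℝⁿ, λ > 0, and let q: ℝ^p → ℝ be convex and continuously differentiable. Define f(β) = (1/2)‖Xβ − y‖² + λ‖β‖₁ − q(β). Let (σ^{2,k})_{k≥0} be positive reals converging to σ^{2,∞} > 0, and let (β^k)_{k≥0}, (δ^k)_{k≥0} in ℝ^p be such that for every k, β^{k+1} is a global minimizer of β ↦ J_k(β) + ⟨δ^k, β − β^k⟩, where J_k(β) = (1/2)‖Xβ − y‖² + λ‖β‖₁ − q(β^k) − ⟨∇q(β^k), β − β^k⟩ + (σ^{2,k}/2)‖β − β^k‖², and ‖δ^k‖ ≤ (σ^{2,k}/4)‖β^{k+1} − β^k‖. If f is bounded below on ℝ^p, then every accumulation point of the sequence (β^k) is a d-stationary point of f. -/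

import Mathlib

open Filter Topology

/-- Euclidean norm on `Fin m → ℝ`. -/
noncomputable def euclNorm {m : ℕ} (x : Fin m → ℝ) : ℝ := Real.sqrt (∑ i, (x i) ^ 2)

/-- ℓ₁ norm on `Fin m → ℝ`. -/
noncomputable def l1Norm {m : ℕ} (x : Fin m → ℝ) : ℝ := ∑ i, |x i|

/-- Euclidean inner product on `Fin m → ℝ`. -/
noncomputable def dotp {m : ℕ} (x y : Fin m → ℝ) : ℝ := ∑ i, x i * y i

/-- The continuous linear functional `v ↦ ⟨g, v⟩` on `Fin m → ℝ`. -/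
noncomputable def dotCLM {m : ℕ} (g : Fin m → ℝ) : (Fin m → ℝ) →L[ℝ] ℝ :=
  ∑ i, g i • ContinuousLinearMap.proj i

/-- The objective `f(β) = (1/2)‖Xβ − y‖² + λ‖β‖₁ − q(β)`. -/
noncomputable def fObj {n p : ℕ} (X : Matrix (Fin n) (Fin p) ℝ) (y : Fin n → ℝ)
    (lam : ℝ) (q : (Fin p → ℝ) → ℝ) (β : Fin p → ℝ) : ℝ :=
  (1 / 2) * (euclNorm (X.mulVec β - y)) ^ 2 + lam * l1Norm β - q β

/-- The majorization `J_k(β)`. -/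
noncomputable def Jmaj {n p : ℕ} (X : Matrix (Fin n) (Fin p) ℝ) (y : Fin n → ℝ)
    (lam sigma : ℝ) (q : (Fin p → ℝ) → ℝ) (g : (Fin p → ℝ) → (Fin p → ℝ))
    (βk β : Fin p → ℝ) : ℝ :=
  (1 / 2) * (euclNorm (X.mulVec β - y)) ^ 2 + lam * l1Norm β - q βk
    - dotp (g βk) (β - βk) + (sigma / 2) * (euclNorm (β - βk)) ^ 2

lemma euclNorm_nonneg {m : ℕ} (x : Fin m → ℝ) : 0 ≤ euclNorm x := Real.sqrt_nonneg _

lemma euclNorm_sq {m : ℕ} (x : Fin m → ℝ) : euclNorm x ^ 2 = ∑ i, x i ^ 2 :=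
  Real.sq_sqrt (Finset.sum_nonneg fun _ _ => sq_nonneg _)

lemma euclNorm_zero {m : ℕ} : euclNorm (0 : Fin m → ℝ) = 0 := by simp [euclNorm]

lemma euclNorm_smul_sq {m : ℕ} (t : ℝ) (x : Fin m → ℝ) :
    euclNorm (t • x) ^ 2 = t ^ 2 * euclNorm x ^ 2 := by
  simp [euclNorm_sq, mul_pow, Finset.mul_sum]

lemma abs_apply_le_euclNorm {m : ℕ} (x : Fin m → ℝ) (i : Fin m) : |x i| ≤ euclNorm x :=
  Real.abs_le_sqrt
    (Finset.single_le_sum (f := fun i => x i ^ 2) (fun _ _ => sq_nonneg _) (Finset.mem_univ i))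

lemma continuous_euclNorm {m : ℕ} : Continuous (euclNorm : (Fin m → ℝ) → ℝ) := by
  unfold euclNorm
  fun_prop

lemma continuous_l1Norm {m : ℕ} : Continuous (l1Norm : (Fin m → ℝ) → ℝ) := by
  unfold l1Norm
  fun_prop

lemma continuous_dotp {m : ℕ} :
    Continuous fun z : (Fin m → ℝ) × (Fin m → ℝ) => dotp z.1 z.2 := by
  unfold dotp
  fun_prop

lemma dotp_zero {m : ℕ} (x : Fin m → ℝ) : dotp x 0 = 0 := by simp [dotp]

lemma dotp_smul {m : ℕ} (t : ℝ) (x y : Fin m → ℝ) : dotp x (t • y) = t * dotp x y := by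
  simp only [dotp, Pi.smul_apply, smul_eq_mul, Finset.mul_sum]
  exact Finset.sum_congr rfl fun _ _ => by ring

lemma neg_dotp_le {m : ℕ} (x y : Fin m → ℝ) : -dotp x y ≤ euclNorm x * euclNorm y := by
  simpa [dotp, euclNorm] using
    Real.sum_mul_le_sqrt_mul_sqrt Finset.univ (fun i => -x i) y

lemma dotCLM_apply {m : ℕ} (g v : Fin m → ℝ) : dotCLM g v = dotp g v := by
  simp [dotCLM, dotp]

lemma hasDerivAt_line {m : ℕ} {q : (Fin m → ℝ) → ℝ} {g b : Fin m → ℝ}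
    (hq : HasFDerivAt q (dotCLM g) b) (h : Fin m → ℝ) :
    HasDerivAt (fun t : ℝ => q (b + t • h)) (dotp g h) 0 := by
  have hline : HasDerivAt (fun t : ℝ => b + t • h) h 0 := by
    simpa using ((hasDerivAt_id (0 : ℝ)).smul_const h).const_add b
  rw [← dotCLM_apply]
  exact HasFDerivAt.comp_hasDerivAt (0 : ℝ) (by simpa using hq) hline

/-- The gradient inequality for a convex function. -/
lemma ConvexOn.add_dotp_le {m : ℕ} {q : (Fin m → ℝ) → ℝ} {g a : Fin m → ℝ}
    (hconv : ConvexOn ℝ Set.univ q) (hq : HasFDerivAt q (dotCLM g) a) (b : Fin m → ℝ) :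
    q a + dotp g (b - a) ≤ q b := by
  have hc : ConvexOn ℝ Set.univ (fun t : ℝ => q (a + t • (b - a))) := by
    have := hconv.comp_affineMap (AffineMap.lineMap (k := ℝ) a b)
    refine this.congr fun t _ => ?_
    simp [AffineMap.lineMap_apply, add_comm]
  have := hc.le_slope_of_hasDerivAt (Set.mem_univ 0) (Set.mem_univ 1) one_pos
    (hasDerivAt_line hq (b - a))
  simp only [slope_def_field, one_smul, zero_smul, add_zero, add_sub_cancel] at this
  linarith

lemma differentiableWithinAt_abs_line (x h : ℝ) :
    DifferentiableWithinAt ℝ (fun t : ℝ => |x + t * h|) (Set.Ioi 0) 0 := by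
  have hc : ConvexOn ℝ Set.univ (fun t : ℝ => |x + t * h|) := by
    have := (convexOn_univ_norm (E := ℝ)).comp_affineMap (AffineMap.lineMap (k := ℝ) x (x + h))
    refine this.congr fun t _ => ?_
    simp [AffineMap.lineMap_apply, add_comm]
  exact hc.differentiableWithinAt_Ioi_of_mem_interior (by simp)

/-- The one-sided directional derivatives of `fObj` exist wherever `q` is differentiable. -/
lemma differentiableWithinAt_fObj_line {n p : ℕ} (X : Matrix (Fin n) (Fin p) ℝ) (y : Fin n → ℝ)
    (lam : ℝ) {q : (Fin p → ℝ) → ℝ} {g b : Fin p → ℝ} (hq : HasFDerivAt q (dotCLM g) b)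
    (h : Fin p → ℝ) :
    DifferentiableWithinAt ℝ (fun t : ℝ => fObj X y lam q (b + t • h)) (Set.Ioi 0) 0 := by
  unfold fObj
  refine DifferentiableWithinAt.sub (DifferentiableWithinAt.add ?_ ?_)
    (hasDerivAt_line hq h).differentiableAt.differentiableWithinAt
  · simp only [euclNorm_sq, Matrix.mulVec_add, Matrix.mulVec_smul, Pi.sub_apply, Pi.add_apply,
      Pi.smul_apply, smul_eq_mul]
    fun_prop
  · simp only [l1Norm, Pi.add_apply, Pi.smul_apply, smul_eq_mul]
    exact (DifferentiableWithinAt.fun_sum fun i _ =>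
      differentiableWithinAt_abs_line (b i) (h i)).const_mul lam

/-- A minimizer of its own majorization is d-stationary. -/
lemma exists_tendsto_of_Jmaj_le {n p : ℕ} {X : Matrix (Fin n) (Fin p) ℝ} {y : Fin n → ℝ}
    {lam s : ℝ} {q : (Fin p → ℝ) → ℝ} {g : (Fin p → ℝ) → (Fin p → ℝ)} {a : Fin p → ℝ}
    (hq : HasFDerivAt q (dotCLM (g a)) a)
    (hmin : ∀ b, Jmaj X y lam s q g a a ≤ Jmaj X y lam s q g a b) (h : Fin p → ℝ) :
    ∃ D : ℝ, 0 ≤ D ∧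
      Tendsto (fun t : ℝ => (fObj X y lam q (a + t • h) - fObj X y lam q a) / t)
        (nhdsWithin 0 (Set.Ioi 0)) (nhds D) := by
  have hD := (hasDerivWithinAt_iff_tendsto_slope' Set.self_notMem_Ioi).mp
    (differentiableWithinAt_fObj_line X y lam hq h).hasDerivWithinAt
  simp only [slope_fun_def_field, zero_smul, add_zero, sub_zero] at hD
  refine ⟨_, ?_, hD⟩
  have hQ := (hasDerivWithinAt_iff_tendsto_slope' Set.self_notMem_Ioi).mp
    ((hasDerivAt_line hq h).hasDerivWithinAt (s := Set.Ioi 0))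
  simp only [slope_fun_def_field, zero_smul, add_zero, sub_zero] at hQ
  have hid : Tendsto (fun t : ℝ => s / 2 * t * euclNorm h ^ 2) (𝓝[>] 0) (𝓝 0) := by
    have : Continuous fun t : ℝ => s / 2 * t * euclNorm h ^ 2 := by fun_prop
    simpa using (this.tendsto 0).mono_left nhdsWithin_le_nhds
  have hlow := ((tendsto_const_nhds (x := dotp (g a) h)).sub hid).sub hQ
  rw [show dotp (g a) h - 0 - dotp (g a) h = 0 by ring] at hlow
  refine le_of_tendsto_of_tendsto hlow hD ?_
  filter_upwards [self_mem_nhdsWithin] with t (ht : 0 < t)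
  have := hmin (a + t • h)
  simp only [Jmaj, sub_self, dotp_zero, euclNorm_zero, add_sub_cancel_left, dotp_smul,
    euclNorm_smul_sq] at this
  rw [le_div_iff₀ ht, sub_mul, div_mul_cancel₀ _ ht.ne']
  simp only [fObj]
  linarith

lemma continuous_Jmaj {n p : ℕ} (X : Matrix (Fin n) (Fin p) ℝ) (y : Fin n → ℝ)
    (lam : ℝ) {q : (Fin p → ℝ) → ℝ} {g : (Fin p → ℝ) → (Fin p → ℝ)}
    (hq : Continuous q) (hg : Continuous g) :
    Continuous fun z : ℝ × (Fin p → ℝ) × (Fin p → ℝ) => Jmaj X y lam z.1 q g z.2.1 z.2.2 := by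
  unfold Jmaj
  have h1 : Continuous fun z : ℝ × (Fin p → ℝ) × (Fin p → ℝ) =>
      euclNorm (X.mulVec z.2.2 - y) := continuous_euclNorm.comp (by fun_prop)
  have h2 : Continuous fun z : ℝ × (Fin p → ℝ) × (Fin p → ℝ) => l1Norm z.2.2 :=
    continuous_l1Norm.comp (by fun_prop)
  have h3 : Continuous fun z : ℝ × (Fin p → ℝ) × (Fin p → ℝ) =>
      dotp (g z.2.1) (z.2.2 - z.2.1) :=
    continuous_dotp.comp (f := fun z : ℝ × (Fin p → ℝ) × (Fin p → ℝ) =>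
      (g z.2.1, z.2.2 - z.2.1)) (by fun_prop)
  have h4 : Continuous fun z : ℝ × (Fin p → ℝ) × (Fin p → ℝ) => euclNorm (z.2.2 - z.2.1) :=
    continuous_euclNorm.comp (by fun_prop)
  fun_prop

/-- Sufficient decrease for one inexact majorized step. -/
lemma fObj_add_le_of_Jmaj_le {n p : ℕ} {X : Matrix (Fin n) (Fin p) ℝ} {y : Fin n → ℝ}
    {lam s : ℝ} {q : (Fin p → ℝ) → ℝ} {g : (Fin p → ℝ) → (Fin p → ℝ)} {a b d : Fin p → ℝ}
    (hconv : ConvexOn ℝ Set.univ q) (hq : HasFDerivAt q (dotCLM (g a)) a)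
    (hmin : Jmaj X y lam s q g a b + dotp d (b - a) ≤
      Jmaj X y lam s q g a a + dotp d (a - a))
    (hd : euclNorm d ≤ s / 4 * euclNorm (b - a)) :
    fObj X y lam q b + s / 4 * euclNorm (b - a) ^ 2 ≤ fObj X y lam q a := by
  have h1 := hconv.add_dotp_le hq b
  have h2 := neg_dotp_le d (b - a)
  have h3 := mul_le_mul_of_nonneg_right hd (euclNorm_nonneg (b - a))
  simp only [Jmaj, sub_self, dotp_zero, euclNorm_zero] at hmin
  simp only [fObj]
  nlinarith

lemma tendsto_euclNorm_zero_of_sufficient_decrease {m : ℕ} {F s : ℕ → ℝ} {sinf c : ℝ}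
    {v : ℕ → Fin m → ℝ} (hs : ∀ k, 0 < s k) (hsinf : 0 < sinf)
    (hslim : Tendsto s atTop (𝓝 sinf)) (hc : ∀ k, c ≤ F k)
    (hF : ∀ k, F (k + 1) + s k / 4 * euclNorm (v k) ^ 2 ≤ F k) :
    Tendsto (fun k => euclNorm (v k)) atTop (𝓝 0) := by
  have hanti : Antitone F := antitone_nat_of_succ_le fun k => by
    have := hF k
    have := mul_nonneg (div_pos (hs k) four_pos).le (sq_nonneg (euclNorm (v k)))
    linarith
  have hlim := tendsto_atTop_ciInf hanti ⟨c, by rintro _ ⟨k, rfl⟩; exact hc k⟩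
  have hdiff := hlim.sub (hlim.comp (tendsto_add_atTop_nat 1))
  have hub : Tendsto (fun k => (F k - F (k + 1)) / (s k / 4)) atTop (𝓝 0) := by
    have := hdiff.div (hslim.div_const 4) (by positivity)
    simpa [Pi.div_def] using this
  have hsq : Tendsto (fun k => euclNorm (v k) ^ 2) atTop (𝓝 0) := by
    refine squeeze_zero (fun k => sq_nonneg _) (fun k => ?_) hub
    rw [le_div_iff₀ (div_pos (hs k) four_pos)]
    linarith [hF k]
  simpa [Real.sqrt_sq (euclNorm_nonneg _)] using hsq.sqrt

lemma tendsto_zero_of_euclNorm {m : ℕ} {ι : Type*} {l : Filter ι} {v : ι → Fin m → ℝ}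
    (hv : Tendsto (fun k => euclNorm (v k)) l (𝓝 0)) : Tendsto v l (𝓝 0) :=
  tendsto_pi_nhds.mpr fun i =>
    squeeze_zero_norm (fun k => abs_apply_le_euclNorm (v k) i) hv

/-- if `f` is bounded below, every accumulation point of the PMM sequence
`(β^k)` is a d-stationary point of `f`. -/
theorem pmm_accumulation_is_dStationary {n p : ℕ} (lam : ℝ) (hlam : 0 < lam)
    (X : Matrix (Fin n) (Fin p) ℝ) (y : Fin n → ℝ)
    (q : (Fin p → ℝ) → ℝ) (g : (Fin p → ℝ) → (Fin p → ℝ))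
    (hqconv : ConvexOn ℝ Set.univ q)
    (hqdiff : ∀ β : Fin p → ℝ, HasFDerivAt q (dotCLM (g β)) β)
    (hgcont : Continuous g)
    (σ2 : ℕ → ℝ) (hσ2 : ∀ k, 0 < σ2 k)
    (σ2inf : ℝ) (hσ2inf : 0 < σ2inf) (hσ2lim : Tendsto σ2 atTop (nhds σ2inf))
    (β : ℕ → Fin p → ℝ) (δ : ℕ → Fin p → ℝ)
    (hmin : ∀ k, ∀ b : Fin p → ℝ,
      Jmaj X y lam (σ2 k) q g (β k) (β (k + 1)) + dotp (δ k) (β (k + 1) - β k)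
        ≤ Jmaj X y lam (σ2 k) q g (β k) b + dotp (δ k) (b - β k))
    (hδ : ∀ k, euclNorm (δ k) ≤ (σ2 k / 4) * euclNorm (β (k + 1) - β k))
    (hbdd : ∃ c : ℝ, ∀ b : Fin p → ℝ, c ≤ fObj X y lam q b) :
    ∀ βbar : Fin p → ℝ, MapClusterPt βbar atTop β →
      ∀ h : Fin p → ℝ, ∃ D : ℝ, 0 ≤ D ∧
        Tendsto (fun t : ℝ => (fObj X y lam q (βbar + t • h) - fObj X y lam q βbar) / t)
          (nhdsWithin 0 (Set.Ioi 0)) (nhds D) := by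
  intro βbar hβbar h
  obtain ⟨c, hc⟩ := hbdd
  have hstep : Tendsto (fun k => euclNorm (β (k + 1) - β k)) atTop (𝓝 0) :=
    tendsto_euclNorm_zero_of_sufficient_decrease (F := fun k => fObj X y lam q (β k))
      hσ2 hσ2inf hσ2lim (fun k => hc _)
      fun k => fObj_add_le_of_Jmaj_le hqconv (hqdiff _) (hmin k (β k)) (hδ k)
  have hδ0 : Tendsto δ atTop (𝓝 0) := by
    refine tendsto_zero_of_euclNorm (squeeze_zero (fun k => euclNorm_nonneg _) hδ ?_)
    simpa using (hσ2lim.div_const 4).mul hstep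
  obtain ⟨φ, hφ, hβφ⟩ := hβbar.tendsto_subseq
  have hsucc : Tendsto (fun j => β (φ j + 1)) atTop (𝓝 βbar) := by
    have := ((tendsto_zero_of_euclNorm hstep).comp hφ.tendsto_atTop).add hβφ
    simpa [Function.comp_def] using this
  have hqcont : Continuous q :=
    continuous_iff_continuousAt.mpr fun b => (hqdiff b).continuousAt
  have hlim {b : ℕ → Fin p → ℝ} {b' : Fin p → ℝ} (hb : Tendsto b atTop (𝓝 b')) :
      Tendsto (fun j => Jmaj X y lam (σ2 (φ j)) q g (β (φ j)) (b j)
          + dotp (δ (φ j)) (b j - β (φ j))) atTop (𝓝 (Jmaj X y lam σ2inf q g βbar b')) := by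
    have h1 := ((continuous_Jmaj X y lam hqcont hgcont).tendsto (σ2inf, βbar, b')).comp
      ((hσ2lim.comp hφ.tendsto_atTop).prodMk_nhds (hβφ.prodMk_nhds hb))
    have h2 := (continuous_dotp.tendsto (0, b' - βbar)).comp
      ((hδ0.comp hφ.tendsto_atTop).prodMk_nhds (hb.sub hβφ))
    have h3 := h1.add h2
    simpa [dotp, Function.comp_def] using h3
  refine exists_tendsto_of_Jmaj_le (s := σ2inf) (hqdiff βbar) (fun b => ?_) h
  exact le_of_tendsto_of_tendsto' (hlim hsucc) (hlim tendsto_const_nhds) fun j => hmin (φ j) b
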